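/- Let P be a polymatroid on [n]. Then for every permutation w ∈ S_n, 𝒯_P(x,y) = 𝒯_{w(P)}(x,y); that is, the polymatroid Tutte polynomial does not depend on the chosen linear order of the ground set. -/

import Mathlib

open Finset

/-- The `i`-th standard basis vector in `ℤ^n`. -/
def e {n : ℕ} (i : Fin n) : Fin n → ℤ := fun t => if t = i then 1 else 0

/-- Membership characterization of the polymatroid `P_f`. -/
def IsPolymatroid {n : ℕ} (P : Set (Fin n → ℤ)) (f : Finset (Fin n) → ℤ) : Prop :=
  (f ∅ = 0) ∧ (∀ I J : Finset (Fin n), f (I ∪ J) + f (I ∩ J) ≤ f I + f J) ∧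
    (∀ a : Fin n → ℤ, a ∈ P ↔
      (∀ I : Finset (Fin n), ∑ t ∈ I, a t ≤ f I) ∧ ∑ t, a t = f univ)

/-- `i` is internally active w.r.t. the basis `a` of `P` for the order `lt`. -/
def IntActO {n : ℕ} (P : Set (Fin n → ℤ)) (lt : Fin n → Fin n → Prop)
    (a : Fin n → ℤ) (i : Fin n) : Prop :=
  ∀ j : Fin n, lt j i → a - e i + e j ∉ P

/-- `i` is externally active w.r.t. the basis `a` of `P` for the order `lt`. -/
def ExtActO {n : ℕ} (P : Set (Fin n → ℤ)) (lt : Fin n → Fin n → Prop)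
    (a : Fin n → ℤ) (i : Fin n) : Prop :=
  ∀ j : Fin n, lt j i → a + e i - e j ∉ P

/-- Internal activity for the natural order on `Fin n`. -/
def IntAct {n : ℕ} (P : Set (Fin n → ℤ)) (a : Fin n → ℤ) (i : Fin n) : Prop :=
  IntActO P (· < ·) a i

/-- External activity for the natural order on `Fin n`. -/
def ExtAct {n : ℕ} (P : Set (Fin n → ℤ)) (a : Fin n → ℤ) (i : Fin n) : Prop :=
  ExtActO P (· < ·) a i

noncomputable def oi {n : ℕ} (P : Set (Fin n → ℤ)) (a : Fin n → ℤ) : ℕ :=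
  {i : Fin n | IntAct P a i ∧ ¬ ExtAct P a i}.ncard

noncomputable def oe {n : ℕ} (P : Set (Fin n → ℤ)) (a : Fin n → ℤ) : ℕ :=
  {i : Fin n | ExtAct P a i ∧ ¬ IntAct P a i}.ncard

noncomputable def ie {n : ℕ} (P : Set (Fin n → ℤ)) (a : Fin n → ℤ) : ℕ :=
  {i : Fin n | IntAct P a i ∧ ExtAct P a i}.ncard

/-- The polymatroid Tutte polynomial evaluated at `(x, y)`. -/
noncomputable def TP {n : ℕ} (P : Set (Fin n → ℤ)) {R : Type*} [CommRing R]
    (x y : R) : R :=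
  ∑ᶠ a ∈ P, x ^ oi P a * y ^ oe P a * (x + y - 1) ^ ie P a


/-- internal activity relative to a set of predecessors -/
def IA {n : ℕ} (P : Set (Fin n → ℤ)) (L : Finset (Fin n)) (a : Fin n → ℤ) (i : Fin n) : Prop :=
  ∀ j ∈ L, a - e i + e j ∉ P

/-- external activity relative to a set of predecessors -/
def EA {n : ℕ} (P : Set (Fin n → ℤ)) (L : Finset (Fin n)) (a : Fin n → ℤ) (i : Fin n) : Prop :=
  ∀ j ∈ L, a + e i - e j ∉ P

/-- tight sets -/
def Tight {n : ℕ} (f : Finset (Fin n) → ℤ) (a : Fin n → ℤ) (S : Finset (Fin n)) : Prop :=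
  ∑ t ∈ S, a t = f S

lemma sum_exch {n : ℕ} (a : Fin n → ℤ) (i j : Fin n) (S : Finset (Fin n)) :
    ∑ t ∈ S, (a - e i + e j) t =
      ∑ t ∈ S, a t - (if i ∈ S then 1 else 0) + (if j ∈ S then 1 else 0) := by
  simp [e, Finset.sum_add_distrib, Finset.sum_sub_distrib]

lemma tight_union_inter {n : ℕ} {P : Set (Fin n → ℤ)} {f : Finset (Fin n) → ℤ}
    (hP : IsPolymatroid P f) {a : Fin n → ℤ} (ha : a ∈ P) {S T : Finset (Fin n)}
    (hS : Tight f a S) (hT : Tight f a T) : Tight f a (S ∪ T) ∧ Tight f a (S ∩ T) := by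
  have h1 := ((hP.2.2 a).1 ha).1
  have h2 := hP.2.1 S T
  have h3 := Finset.sum_union_inter (s₁ := S) (s₂ := T) (f := a)
  have h4 := h1 (S ∪ T)
  have h5 := h1 (S ∩ T)
  unfold Tight at *
  constructor <;> linarith

lemma exch_iff {n : ℕ} {P : Set (Fin n → ℤ)} {f : Finset (Fin n) → ℤ}
    (hP : IsPolymatroid P f) {a : Fin n → ℤ} (ha : a ∈ P) (i j : Fin n) :
    a - e i + e j ∈ P ↔ ∀ S, Tight f a S → j ∈ S → i ∈ S := by
  have h1 := (hP.2.2 a).1 ha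
  rw [hP.2.2]
  constructor
  · rintro ⟨h, -⟩ S hS hj
    by_contra hi
    have := h S
    rw [sum_exch, if_pos hj, if_neg hi, hS] at this
    linarith
  · intro h
    refine ⟨fun S => ?_, ?_⟩
    · rw [sum_exch]
      have h2 := h1.1 S
      have h3 := h S
      by_cases hS : Tight f a S
      · have h4 := h3 hS
        unfold Tight at hS
        split_ifs <;> first | linarith | tauto
      · unfold Tight at hS
        have : ∑ t ∈ S, a t < f S := lt_of_le_of_ne h2 hS
        split_ifs <;> omega
    · rw [sum_exch]
      simp [h1.2]

lemma exch_iff' {n : ℕ} {P : Set (Fin n → ℤ)} {f : Finset (Fin n) → ℤ}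
    (hP : IsPolymatroid P f) {a : Fin n → ℤ} (ha : a ∈ P) (i j : Fin n) :
    a + e i - e j ∈ P ↔ ∀ S, Tight f a S → i ∈ S → j ∈ S := by
  rw [← exch_iff hP ha j i]
  have : a + e i - e j = a - e j + e i := by abel
  rw [this]

lemma tight_empty {n : ℕ} {P : Set (Fin n → ℤ)} {f : Finset (Fin n) → ℤ}
    (hP : IsPolymatroid P f) (a : Fin n → ℤ) : Tight f a ∅ := by
  simp [Tight, hP.1]

lemma tight_univ {n : ℕ} {P : Set (Fin n → ℤ)} {f : Finset (Fin n) → ℤ}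
    (hP : IsPolymatroid P f) {a : Fin n → ℤ} (ha : a ∈ P) : Tight f a univ :=
  ((hP.2.2 a).1 ha).2

lemma IA_iff {n : ℕ} {P : Set (Fin n → ℤ)} {f : Finset (Fin n) → ℤ}
    (hP : IsPolymatroid P f) {a : Fin n → ℤ} (ha : a ∈ P) (L : Finset (Fin n)) (i : Fin n) :
    IA P L a i ↔ ∃ S, Tight f a S ∧ L ⊆ S ∧ i ∉ S := by
  induction L using Finset.induction_on with
  | empty =>
    refine ⟨fun _ => ⟨∅, tight_empty hP a, by simp, by simp⟩, fun _ j hj => by simp at hj⟩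
  | insert j L hj ih =>
    have : IA P (insert j L) a i ↔ (a - e i + e j ∉ P ∧ IA P L a i) := by
      simp [IA]
    rw [this, ih, exch_iff hP ha]
    push Not
    constructor
    · rintro ⟨⟨S, hS, h1, h2⟩, T, hT, h3, h4⟩
      refine ⟨S ∪ T, (tight_union_inter hP ha hS hT).1, ?_, by simp [h2, h4]⟩
      intro t ht
      rcases Finset.mem_insert.1 ht with rfl | ht
      · simp [h1]
      · simp [h3 ht]
    · rintro ⟨S, hS, h1, h2⟩
      rw [Finset.insert_subset_iff] at h1
      exact ⟨⟨S, hS, h1.1, h2⟩, S, hS, h1.2, h2⟩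

lemma EA_iff {n : ℕ} {P : Set (Fin n → ℤ)} {f : Finset (Fin n) → ℤ}
    (hP : IsPolymatroid P f) {a : Fin n → ℤ} (ha : a ∈ P) (L : Finset (Fin n)) (i : Fin n) :
    EA P L a i ↔ ∃ S, Tight f a S ∧ (∀ j ∈ L, j ∉ S) ∧ i ∈ S := by
  induction L using Finset.induction_on with
  | empty =>
    refine ⟨fun _ => ⟨univ, tight_univ hP ha, by simp, by simp⟩, fun _ j hj => by simp at hj⟩
  | insert j L hj ih =>
    have : EA P (insert j L) a i ↔ (a + e i - e j ∉ P ∧ EA P L a i) := by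
      simp [EA]
    rw [this, ih, exch_iff' hP ha]
    push Not
    constructor
    · rintro ⟨⟨S, hS, h1, h2⟩, T, hT, h3, h4⟩
      refine ⟨S ∩ T, (tight_union_inter hP ha hS hT).2, ?_, by simp [h1, h4]⟩
      intro t ht
      rcases Finset.mem_insert.1 ht with rfl | ht
      · simp [h2]
      · simp [h3 t ht]
    · rintro ⟨S, hS, h1, h2⟩
      rw [Finset.forall_mem_insert] at h1
      exact ⟨⟨S, hS, h2, h1.1⟩, S, hS, h1.2, h2⟩

lemma finite_P {n : ℕ} {P : Set (Fin n → ℤ)} {f : Finset (Fin n) → ℤ}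
    (hP : IsPolymatroid P f) : P.Finite := by
  refine (Set.finite_Icc (fun i => f univ - f (univ.erase i)) (fun i => f {i})).subset ?_
  intro a ha
  have h := (hP.2.2 a).1 ha
  refine ⟨fun i => ?_, fun i => ?_⟩
  · have h1 := h.1 (univ.erase i)
    have h2 := Finset.add_sum_erase univ a (Finset.mem_univ i)
    have h3 := h.2
    simp only
    linarith
  · simpa using h.1 {i}

open Classical in
/-- weight of one element -/
noncomputable def wt {R : Type*} [CommRing R] (x y : R) (I E : Prop) : R :=
  if I then (if E then x + y - 1 else x) else (if E then y else 1)

/-- total weight -/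
noncomputable def GW {n : ℕ} (P : Set (Fin n → ℤ)) {R : Type*} [CommRing R] (x y : R)
    (L : Fin n → Finset (Fin n)) (a : Fin n → ℤ) : R :=
  ∏ i, wt x y (IA P (L i) a i) (EA P (L i) a i)

/-- weight away from p, q -/
noncomputable def restW {n : ℕ} (P : Set (Fin n → ℤ)) {R : Type*} [CommRing R] (x y : R)
    (L : Fin n → Finset (Fin n)) (p q : Fin n) (a : Fin n → ℤ) : R :=
  ∏ i ∈ (univ.erase p).erase q, wt x y (IA P (L i) a i) (EA P (L i) a i)

lemma GW_eq {n : ℕ} (P : Set (Fin n → ℤ)) {R : Type*} [CommRing R] (x y : R)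
    (L : Fin n → Finset (Fin n)) (p q : Fin n) (hpq : p ≠ q) (a : Fin n → ℤ) :
    GW P x y L a = wt x y (IA P (L p) a p) (EA P (L p) a p) *
      wt x y (IA P (L q) a q) (EA P (L q) a q) * restW P x y L p q a := by
  unfold GW restW
  rw [← Finset.mul_prod_erase univ _ (Finset.mem_univ p),
    ← Finset.mul_prod_erase (univ.erase p) _ (Finset.mem_erase.2 ⟨hpq.symm, Finset.mem_univ q⟩),
    mul_assoc]

def Cc {n : ℕ} (f : Finset (Fin n) → ℤ) (A : Finset (Fin n)) (p q : Fin n)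
    (a : Fin n → ℤ) : Prop := ∃ S, Tight f a S ∧ A ⊆ S ∧ p ∉ S ∧ q ∉ S

def Dd {n : ℕ} (f : Finset (Fin n) → ℤ) (A : Finset (Fin n)) (p q : Fin n)
    (a : Fin n → ℤ) : Prop := ∃ S, Tight f a S ∧ (∀ j ∈ A, j ∉ S) ∧ p ∈ S ∧ q ∈ S

lemma tight_shift {n : ℕ} {f : Finset (Fin n) → ℤ} {a : Fin n → ℤ} {p q : Fin n}
    {S : Finset (Fin n)} (h : p ∈ S ↔ q ∈ S) : Tight f (a + e p - e q) S ↔ Tight f a S := by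
  have : a + e p - e q = a - e q + e p := by abel
  rw [this]
  unfold Tight
  rw [sum_exch]
  simp [h]

lemma Cc_shift {n : ℕ} {f : Finset (Fin n) → ℤ} {A : Finset (Fin n)} {a : Fin n → ℤ}
    {p q : Fin n} : Cc f A p q (a + e p - e q) ↔ Cc f A p q a := by
  unfold Cc
  refine exists_congr fun S => ?_
  constructor
  · rintro ⟨h1, h2, h3, h4⟩
    exact ⟨(tight_shift (by tauto)).1 h1, h2, h3, h4⟩
  · rintro ⟨h1, h2, h3, h4⟩
    exact ⟨(tight_shift (by tauto)).2 h1, h2, h3, h4⟩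

lemma Dd_shift {n : ℕ} {f : Finset (Fin n) → ℤ} {A : Finset (Fin n)} {a : Fin n → ℤ}
    {p q : Fin n} : Dd f A p q (a + e p - e q) ↔ Dd f A p q a := by
  unfold Dd
  refine exists_congr fun S => ?_
  constructor
  · rintro ⟨h1, h2, h3, h4⟩
    exact ⟨(tight_shift (by tauto)).1 h1, h2, h3, h4⟩
  · rintro ⟨h1, h2, h3, h4⟩
    exact ⟨(tight_shift (by tauto)).2 h1, h2, h3, h4⟩

lemma IA_bal {n : ℕ} {P : Set (Fin n → ℤ)} {f : Finset (Fin n) → ℤ}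
    (hP : IsPolymatroid P f) {a : Fin n → ℤ} (ha : a ∈ P) (L A : Finset (Fin n)) (i p q : Fin n)
    (h : (p ∈ L ∧ q ∈ L) ∨ (i ∈ A ∧ L ⊆ A)) (hc : Cc f A p q a ∨ Dd f A p q a) :
    IA P L a i ↔ ∃ S, (p ∈ S ↔ q ∈ S) ∧ Tight f a S ∧ L ⊆ S ∧ i ∉ S := by
  rw [IA_iff hP ha]
  constructor
  · rintro ⟨S, hS, hL, hi⟩
    rcases h with ⟨h1, h2⟩ | ⟨h1, h2⟩
    · exact ⟨S, by simp [hL h1, hL h2], hS, hL, hi⟩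
    · rcases hc with ⟨T, hT, h3, h4, h5⟩ | ⟨T, hT, h3, h4, h5⟩
      · exact ⟨S ∩ T, by simp [h4, h5], (tight_union_inter hP ha hS hT).2,
          Finset.subset_inter hL (h2.trans h3), by simp [hi]⟩
      · exact ⟨S ∪ T, by simp [h4, h5], (tight_union_inter hP ha hS hT).1,
          hL.trans Finset.subset_union_left, by simp [hi, h3 i h1]⟩
  · rintro ⟨S, -, h⟩
    exact ⟨S, h⟩

lemma EA_bal {n : ℕ} {P : Set (Fin n → ℤ)} {f : Finset (Fin n) → ℤ}
    (hP : IsPolymatroid P f) {a : Fin n → ℤ} (ha : a ∈ P) (L A : Finset (Fin n)) (i p q : Fin n)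
    (h : (p ∈ L ∧ q ∈ L) ∨ (i ∈ A ∧ L ⊆ A)) (hc : Cc f A p q a ∨ Dd f A p q a) :
    EA P L a i ↔ ∃ S, (p ∈ S ↔ q ∈ S) ∧ Tight f a S ∧ (∀ j ∈ L, j ∉ S) ∧ i ∈ S := by
  rw [EA_iff hP ha]
  constructor
  · rintro ⟨S, hS, hL, hi⟩
    rcases h with ⟨h1, h2⟩ | ⟨h1, h2⟩
    · exact ⟨S, by simp [hL _ h1, hL _ h2], hS, hL, hi⟩
    · rcases hc with ⟨T, hT, h3, h4, h5⟩ | ⟨T, hT, h3, h4, h5⟩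
      · exact ⟨S ∩ T, by simp [h4, h5], (tight_union_inter hP ha hS hT).2,
          fun j hj => by simp [hL j hj], by simp [hi, h3 h1]⟩
      · exact ⟨S ∪ T, by simp [h4, h5], (tight_union_inter hP ha hS hT).1,
          fun j hj => by simp [hL j hj, h3 j (h2 hj)], by simp [hi]⟩
  · rintro ⟨S, -, h⟩
    exact ⟨S, h⟩

open Classical in
/-- the correction term -/
noncomputable def HW {n : ℕ} (P : Set (Fin n → ℤ)) (f : Finset (Fin n) → ℤ)
    {R : Type*} [CommRing R] (x y : R)
    (L : Fin n → Finset (Fin n)) (A : Finset (Fin n)) (p q : Fin n) (a : Fin n → ℤ) : R :=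
  ((if Cc f A p q a then x - x ^ 2 else 0) + (if Dd f A p q a then y ^ 2 - y else 0)) *
    restW P x y L p q a

lemma HW_shift {n : ℕ} {P : Set (Fin n → ℤ)} {f : Finset (Fin n) → ℤ}
    (hP : IsPolymatroid P f) {R : Type*} [CommRing R] (x y : R)
    (L : Fin n → Finset (Fin n)) (A : Finset (Fin n)) (p q : Fin n) {a : Fin n → ℤ}
    (hL : ∀ i, i ≠ p → i ≠ q → (p ∈ L i ∧ q ∈ L i) ∨ (i ∈ A ∧ L i ⊆ A))
    (ha : a ∈ P) (hb : a + e p - e q ∈ P) :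
    HW P f x y L A p q (a + e p - e q) = HW P f x y L A p q a := by
  unfold HW
  have hC0 : Cc f A p q (a + e p - e q) = Cc f A p q a := propext Cc_shift
  have hD0 : Dd f A p q (a + e p - e q) = Dd f A p q a := propext Dd_shift
  rw [hC0, hD0]
  by_cases hc : Cc f A p q a ∨ Dd f A p q a
  · congr 1
    unfold restW
    refine Finset.prod_congr rfl fun i hi => ?_
    simp only [Finset.mem_erase] at hi
    have h := hL i hi.2.1 hi.1
    have hc' : Cc f A p q (a + e p - e q) ∨ Dd f A p q (a + e p - e q) := by
      rwa [Cc_shift, Dd_shift]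
    rw [IA_bal hP ha (L i) A i p q h hc, EA_bal hP ha (L i) A i p q h hc,
      IA_bal hP hb (L i) A i p q h hc', EA_bal hP hb (L i) A i p q h hc']
    congr 1
    · refine propext (exists_congr fun S => and_congr_right fun hS => ?_)
      rw [tight_shift hS]
    · refine propext (exists_congr fun S => and_congr_right fun hS => ?_)
      rw [tight_shift hS]
  · push Not at hc
    simp [hc.1, hc.2]

set_option maxHeartbeats 4000000 in
open Classical in
lemma GW_diff {n : ℕ} {P : Set (Fin n → ℤ)} {f : Finset (Fin n) → ℤ}
    (hP : IsPolymatroid P f) {R : Type*} [CommRing R] (x y : R)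
    (L L' : Fin n → Finset (Fin n)) (A : Finset (Fin n)) (p q : Fin n) (hpq : p ≠ q)
    (h1 : L p = A) (h2 : L q = insert p A) (h3 : L' q = A) (h4 : L' p = insert q A)
    (h5 : ∀ i, i ≠ p → i ≠ q → L' i = L i) {a : Fin n → ℤ} (ha : a ∈ P) :
    GW P x y L a - GW P x y L' a =
      (if a + e p - e q ∈ P then HW P f x y L A p q a else 0) -
      (if a + e q - e p ∈ P then HW P f x y L A p q a else 0) := by
  have hr : restW P x y L' p q a = restW P x y L p q a := by
    unfold restW
    refine Finset.prod_congr rfl fun i hi => ?_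
    simp only [Finset.mem_erase] at hi
    rw [h5 i hi.2.1 hi.1]
  rw [GW_eq P x y L p q hpq, GW_eq P x y L' p q hpq, hr, h1, h2, h3, h4]
  have e1 : IA P (insert p A) a q ↔ (¬ a + e p - e q ∈ P ∧ IA P A a q) := by
    have : a + e p - e q = a - e q + e p := by abel
    rw [this]; simp [IA]
  have e2 : EA P (insert p A) a q ↔ (¬ a + e q - e p ∈ P ∧ EA P A a q) := by
    simp [EA]
  have e3 : IA P (insert q A) a p ↔ (¬ a + e q - e p ∈ P ∧ IA P A a p) := by
    have : a + e q - e p = a - e p + e q := by abel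
    rw [this]; simp [IA]
  have e4 : EA P (insert q A) a p ↔ (¬ a + e p - e q ∈ P ∧ EA P A a p) := by
    simp [EA]
  have c1 : Cc f A p q a → IA P A a p ∧ IA P A a q := by
    rintro ⟨S, hS, k1, k2, k3⟩
    rw [IA_iff hP ha, IA_iff hP ha]
    exact ⟨⟨S, hS, k1, k2⟩, S, hS, k1, k3⟩
  have d1 : Dd f A p q a → EA P A a p ∧ EA P A a q := by
    rintro ⟨S, hS, k1, k2, k3⟩
    rw [EA_iff hP ha, EA_iff hP ha]
    exact ⟨⟨S, hS, k1, k2⟩, S, hS, k1, k3⟩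
  have c2 : a + e p - e q ∈ P → IA P A a q → Cc f A p q a := by
    rw [IA_iff hP ha, exch_iff' hP ha]
    rintro h ⟨S, hS, k1, k2⟩
    exact ⟨S, hS, k1, fun hp => k2 (h S hS hp), k2⟩
  have c3 : a + e q - e p ∈ P → IA P A a p → Cc f A p q a := by
    rw [IA_iff hP ha, exch_iff' hP ha]
    rintro h ⟨S, hS, k1, k2⟩
    exact ⟨S, hS, k1, k2, fun hp => k2 (h S hS hp)⟩
  have d2 : a + e p - e q ∈ P → EA P A a p → Dd f A p q a := by
    rw [EA_iff hP ha, exch_iff' hP ha]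
    rintro h ⟨S, hS, k1, k2⟩
    exact ⟨S, hS, k1, k2, h S hS k2⟩
  have d3 : a + e q - e p ∈ P → EA P A a q → Dd f A p q a := by
    rw [EA_iff hP ha, exch_iff' hP ha]
    rintro h ⟨S, hS, k1, k2⟩
    exact ⟨S, hS, k1, h S hS k2, k2⟩
  unfold HW
  rw [e1, e2, e3, e4]
  generalize restW P x y L p q a = r
  generalize Cc f A p q a = C at *
  generalize Dd f A p q a = D at *
  generalize (a + e p - e q ∈ P) = U at *
  generalize (a + e q - e p ∈ P) = V at *
  generalize IA P A a p = ip at *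
  generalize IA P A a q = iq at *
  generalize EA P A a p = ep at *
  generalize EA P A a q = eq at *
  clear e1 e2 e3 e4
  unfold wt
  by_cases hU : U
  · obtain rfl : C = iq := propext ⟨fun h => (c1 h).2, c2 hU⟩
    obtain rfl : D = ep := propext ⟨fun h => (d1 h).1, d2 hU⟩
    by_cases hV : V
    · obtain rfl : C = ip := propext ⟨fun h => (c1 h).1, c3 hV⟩
      obtain rfl : D = eq := propext ⟨fun h => (d1 h).2, d3 hV⟩
      by_cases hC : C <;> by_cases hD : D <;> simp [hU, hV, hC, hD]
    · have c4 : C → ip := fun h => (c1 h).1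
      have d4 : D → eq := fun h => (d1 h).2
      clear c1 c2 c3 d1 d2 d3
      by_cases hC : C <;> by_cases hD : D <;> by_cases hip : ip <;> by_cases heq : eq <;>
        first
        | exact absurd (c4 hC) hip
        | exact absurd (d4 hD) heq
        | (simp [hU, hV, hC, hD, hip, heq]; try ring)
  · by_cases hV : V
    · obtain rfl : C = ip := propext ⟨fun h => (c1 h).1, c3 hV⟩
      obtain rfl : D = eq := propext ⟨fun h => (d1 h).2, d3 hV⟩
      have c4 : C → iq := fun h => (c1 h).2
      have d4 : D → ep := fun h => (d1 h).1
      clear c1 c2 c3 d1 d2 d3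
      by_cases hC : C <;> by_cases hD : D <;> by_cases hiq : iq <;> by_cases hep : ep <;>
        first
        | exact absurd (c4 hC) hiq
        | exact absurd (d4 hD) hep
        | (simp [hU, hV, hC, hD, hiq, hep]; try ring)
    · simp [hU, hV]

open Classical in
lemma sum_swap {n : ℕ} {P : Set (Fin n → ℤ)} {f : Finset (Fin n) → ℤ}
    (hP : IsPolymatroid P f) {R : Type*} [CommRing R] (x y : R)
    (L L' : Fin n → Finset (Fin n)) (A : Finset (Fin n)) (p q : Fin n) (hpq : p ≠ q)
    (h1 : L p = A) (h2 : L q = insert p A) (h3 : L' q = A) (h4 : L' p = insert q A)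
    (h5 : ∀ i, i ≠ p → i ≠ q → L' i = L i)
    (hL : ∀ i, i ≠ p → i ≠ q → (p ∈ L i ∧ q ∈ L i) ∨ (i ∈ A ∧ L i ⊆ A)) :
    ∑ a ∈ (finite_P hP).toFinset, GW P x y L a = ∑ a ∈ (finite_P hP).toFinset, GW P x y L' a := by
  rw [← sub_eq_zero, ← Finset.sum_sub_distrib]
  rw [Finset.sum_congr rfl fun a ha => GW_diff hP x y L L' A p q hpq h1 h2 h3 h4 h5
    ((Set.Finite.mem_toFinset _).1 ha)]
  rw [Finset.sum_sub_distrib, sub_eq_zero, ← Finset.sum_filter, ← Finset.sum_filter]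
  refine Finset.sum_bij' (fun a _ => a + e p - e q) (fun a _ => a + e q - e p) ?_ ?_ ?_ ?_ ?_
  · intro a ha
    simp only [Finset.mem_filter, Set.Finite.mem_toFinset] at ha ⊢
    refine ⟨ha.2, ?_⟩
    have : a + e p - e q + e q - e p = a := by abel
    rw [this]; exact ha.1
  · intro a ha
    simp only [Finset.mem_filter, Set.Finite.mem_toFinset] at ha ⊢
    refine ⟨ha.2, ?_⟩
    have : a + e q - e p + e p - e q = a := by abel
    rw [this]; exact ha.1
  · intro a _; abel
  · intro a _; abel
  · intro a ha
    simp only [Finset.mem_filter, Set.Finite.mem_toFinset] at ha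
    exact (HW_shift hP x y L A p q hL ha.1 ha.2).symm

/-- predecessors for the order given by a permutation -/
def pre {n : ℕ} (s : Equiv.Perm (Fin n)) (i : Fin n) : Finset (Fin n) :=
  univ.filter fun j => s j < s i

lemma sum_adj {n : ℕ} {P : Set (Fin n → ℤ)} {f : Finset (Fin n) → ℤ}
    (hP : IsPolymatroid P f) {R : Type*} [CommRing R] (x y : R)
    (s : Equiv.Perm (Fin n)) (k l : Fin n) (hkl : l.val = k.val + 1) :
    ∑ a ∈ (finite_P hP).toFinset, GW P x y (pre s) a =
      ∑ a ∈ (finite_P hP).toFinset, GW P x y (pre (Equiv.swap k l * s)) a := by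
  have hne : k ≠ l := by rintro rfl; omega
  have hk : ∀ j, j = s.symm k ↔ s j = k := fun j => by rw [Equiv.eq_symm_apply]
  have hl : ∀ j, j = s.symm l ↔ s j = l := fun j => by rw [Equiv.eq_symm_apply]
  refine sum_swap hP x y (pre s) (pre (Equiv.swap k l * s)) (univ.filter fun j => s j < k)
    (s.symm k) (s.symm l) (by simpa using hne) ?_ ?_ ?_ ?_ ?_ ?_
  · ext j; simp [pre]
  · ext j
    simp only [pre, Finset.mem_filter, Finset.mem_univ, true_and, Finset.mem_insert, hk,
      Equiv.apply_symm_apply, Fin.lt_def, Fin.ext_iff]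
    omega
  · ext j
    simp only [pre, Finset.mem_filter, Finset.mem_univ, true_and, Equiv.Perm.mul_apply,
      Equiv.apply_symm_apply, Equiv.swap_apply_right]
    rw [Equiv.swap_apply_def]
    split_ifs <;> simp only [Fin.lt_def, Fin.ext_iff] at * <;> omega
  · ext j
    simp only [pre, Finset.mem_filter, Finset.mem_univ, true_and, Equiv.Perm.mul_apply,
      Equiv.apply_symm_apply, Equiv.swap_apply_left, Finset.mem_insert, hl]
    rw [Equiv.swap_apply_def]
    split_ifs <;> simp only [Fin.lt_def, Fin.ext_iff] at * <;> omega
  · intro i hi hi'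
    rw [Ne, hk] at hi
    rw [Ne, hl] at hi'
    ext j
    simp only [pre, Finset.mem_filter, Finset.mem_univ, true_and, Equiv.Perm.mul_apply,
      Equiv.swap_apply_of_ne_of_ne hi hi']
    rw [Equiv.swap_apply_def]
    split_ifs <;> simp only [Fin.lt_def, Fin.ext_iff] at * <;> omega
  · intro i hi hi'
    rw [Ne, hk] at hi
    rw [Ne, hl] at hi'
    simp only [pre, Finset.mem_filter, Finset.mem_univ, true_and, Finset.subset_iff,
      Equiv.apply_symm_apply]
    simp only [Fin.lt_def, Fin.ext_iff] at *
    by_cases h : (s i).val < k.val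
    · right
      refine ⟨h, fun j hj => by omega⟩
    · left
      omega

lemma sum_perm {n : ℕ} {P : Set (Fin n → ℤ)} {f : Finset (Fin n) → ℤ}
    (hP : IsPolymatroid P f) {R : Type*} [CommRing R] (x y : R)
    (s : Equiv.Perm (Fin n)) :
    ∑ a ∈ (finite_P hP).toFinset, GW P x y (pre s) a =
      ∑ a ∈ (finite_P hP).toFinset, GW P x y (pre 1) a := by
  cases n with
  | zero => rw [Subsingleton.elim s 1]
  | succ m =>
    have hs : s ∈ Submonoid.closure
        (Set.range fun i : Fin m ↦ Equiv.swap i.castSucc i.succ) := by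
      rw [Equiv.Perm.mclosure_swap_castSucc_succ]; trivial
    induction hs using Submonoid.closure_induction_left with
    | one => rfl
    | mul_left t ht u hu ih =>
      obtain ⟨i, rfl⟩ := ht
      rw [← ih]
      exact (sum_adj hP x y u i.castSucc i.succ (by simp)).symm

lemma weight_prod {n : ℕ} (P : Set (Fin n → ℤ)) {R : Type*} [CommRing R] (x y : R)
    (a : Fin n → ℤ) :
    x ^ oi P a * y ^ oe P a * (x + y - 1) ^ ie P a = ∏ i, wt x y (IntAct P a i) (ExtAct P a i) := by
  classical
  unfold oi oe ie
  rw [Set.ncard_eq_toFinset_card', Set.ncard_eq_toFinset_card', Set.ncard_eq_toFinset_card',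
    ← Finset.prod_const, ← Finset.prod_const, ← Finset.prod_const]
  simp only [Set.toFinset_ofPred, Finset.prod_filter]
  rw [← Finset.prod_mul_distrib, ← Finset.prod_mul_distrib]
  refine Finset.prod_congr rfl fun i _ => ?_
  unfold wt
  by_cases h : IntAct P a i <;> by_cases h' : ExtAct P a i <;> simp [h, h']

lemma TP_image {n : ℕ} {P : Set (Fin n → ℤ)} {f : Finset (Fin n) → ℤ}
    (hP : IsPolymatroid P f) {R : Type*} [CommRing R] (x y : R) (w : Equiv.Perm (Fin n)) :
    TP ((fun b => b ∘ w) '' P) x y =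
      ∑ a ∈ (finite_P hP).toFinset, GW P x y (pre w.symm) a := by
  have hinj : Function.Injective (fun b : Fin n → ℤ => b ∘ w) :=
    w.surjective.injective_comp_right
  unfold TP
  rw [finsum_mem_image hinj.injOn, finsum_mem_eq_finite_toFinset_sum _ (finite_P hP)]
  refine Finset.sum_congr rfl fun a _ => ?_
  rw [weight_prod, GW, ← Equiv.prod_comp w (fun i => wt x y (IA P (pre w.symm i) a i) _)]
  refine Finset.prod_congr rfl fun i _ => ?_
  have he : ∀ i : Fin n, (e i : Fin n → ℤ) = e (w i) ∘ w := by
    intro i; funext t; simp [e]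
  have hI : ∀ i j : Fin n, (a ∘ w - e i + e j ∈ (fun b : Fin n → ℤ => b ∘ w) '' P ↔
      a - e (w i) + e (w j) ∈ P) := by
    intro i j
    rw [he i, he j]
    exact hinj.mem_set_image (s := P) (a := a - e (w i) + e (w j))
  have hE : ∀ i j : Fin n, (a ∘ w + e i - e j ∈ (fun b : Fin n → ℤ => b ∘ w) '' P ↔
      a + e (w i) - e (w j) ∈ P) := by
    intro i j
    rw [he i, he j]
    exact hinj.mem_set_image (s := P) (a := a + e (w i) - e (w j))
  congr 1
  · simp only [IntAct, IntActO, IA, hI, pre, Finset.mem_filter, Finset.mem_univ, true_and,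
      Equiv.symm_apply_apply]
    refine propext ⟨fun h j hj => ?_, fun h j hj => h (w j) (by simpa using hj)⟩
    simpa using h (w.symm j) hj
  · simp only [ExtAct, ExtActO, EA, hE, pre, Finset.mem_filter, Finset.mem_univ, true_and,
      Equiv.symm_apply_apply]
    refine propext ⟨fun h j hj => ?_, fun h j hj => h (w j) (by simpa using hj)⟩
    simpa using h (w.symm j) hj

theorem stmt15 {n : ℕ} (P : Set (Fin n → ℤ)) (f : Finset (Fin n) → ℤ)
    (hP : IsPolymatroid P f) (w : Equiv.Perm (Fin n))
    (Q : Set (Fin n → ℤ)) (hQ : Q = (fun b => b ∘ w) '' P)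
    (R : Type*) [CommRing R] (x y : R) :
    TP P x y = TP Q x y := by
  have h1 := TP_image hP x y (1 : Equiv.Perm (Fin n))
  have h0 : (fun b : Fin n → ℤ => b ∘ (1 : Equiv.Perm (Fin n))) '' P = P := by
    simp
  rw [h0] at h1
  rw [hQ, TP_image hP x y w, h1, sum_perm hP x y, sum_perm hP x y w.symm]
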